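/- arXiv:2501.14840 — 2 statements merged into one kernel-verified Lean document; each statement's English description precedes it below -/
import Mathlib

section
/- (Theorem 3.3 of the paper.) Assume V : ℝ^d → ℝ is three times continuously differentiable and Lipschitz continuous, and its Hessian is uniformly bounded: there exist constants λ̄_L, λ̄_U with λ̄_L·‖v‖² ≤ (∇²V(x))(v,v) ≤ λ̄_U·‖v‖² for all x, v ∈ ℝ^d. Assume d(·,·) : ℝ^d × ℝ^d → ℝ satisfies: (a) for each x, y ↦ d(x,y) is convex and C², with Hessian ∇²_y d(x,y) = 0 if and only if y = x; (b) d(x,y) ≥ 0 with equality iff x = y; (c) for every ε > 0 there is λ̄_ε > 0 such that (∇²_y d(x,y))(v,v) ≥ λ̄_ε·‖v‖² for all v whenever ‖x − y‖ ≥ ε. Let λ₁(x) ≤ λ₂(x) ≤ ⋯ ≤ λ_d(x) denote the eigenvalues of the Hessian matrix ∇²V(x), let Ω₁ := {x : λ₁(x) < 0 < λ₂(x)}, and let Ω′₁ be a nonempty compact subset of Ω₁. Let α, β ∈ ℝ with α + β > 1, and for a unit eigenvector u of ∇²V(x) corresponding to λ₁(x), define W̃_ρ(y; x, u) := (1−α)·V(y)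 + α·V(y − ⟨u, y−x⟩·u) − β·V(x + ⟨u, y−x⟩·u) + ρ·d(x,y). Then there exists ρ̄ > 0 (depending on α, β, and Ω′₁) such that for every ρ > ρ̄, for every x ∈ Ω′₁, and for every choice of unit eigenvector u of ∇²V(x) for λ₁(x), the function y ↦ W̃_ρ(y; x, u) has a unique global minimizer x̂ over ℝ^d, and x̂ ∈ Ω₁. -/
open scoped RealInnerProductSpace

/-- The Hessian of `V` at `x`, as the (continuous linear) derivative of the gradient. -/
noncomputable def hess {n : ℕ} (V : EuclideanSpace ℝ (Fin n) → ℝ)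
    (x : EuclideanSpace ℝ (Fin n)) :
    EuclideanSpace ℝ (Fin n) →L[ℝ] EuclideanSpace ℝ (Fin n) :=
  fderiv ℝ (gradient V) x

/-- The penalized auxiliary function
`W̃_ρ(y; x, u) = (1-α)V(y) + αV(y - ⟨u,y-x⟩u) - βV(x + ⟨u,y-x⟩u) + ρ·d(x,y)`. -/
noncomputable def Wtilde {n : ℕ} (V : EuclideanSpace ℝ (Fin n) → ℝ)
    (p : EuclideanSpace ℝ (Fin n) → EuclideanSpace ℝ (Fin n) → ℝ)
    (α β ρ : ℝ) (x u y : EuclideanSpace ℝ (Fin n)) : ℝ :=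
  (1 - α) * V y + α * V (y - ⟪u, y - x⟫ • u) - β * V (x + ⟪u, y - x⟫ • u) + ρ * p x y

/-- The index-1 region `Ω₁ = {x : λ₁(x) < 0 < λ₂(x)}`, where `lam i x` is the `i`-th
(ascending) eigenvalue of the Hessian of `V` at `x`. -/
def Omega1 {n : ℕ} (hn : 2 ≤ n) (lam : Fin n → EuclideanSpace ℝ (Fin n) → ℝ) :
    Set (EuclideanSpace ℝ (Fin n)) :=
  {x | lam ⟨0, by omega⟩ x < 0 ∧ 0 < lam ⟨1, by omega⟩ x}

section Spectral

variable {ι E : Type*} [Fintype ι] [NormedAddCommGroup E] [InnerProductSpace ℝ E]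

lemma inner_map_eq_sum_eigenbasis (b : OrthonormalBasis ι ℝ E) {T : E →L[ℝ] E} {μ : ι → ℝ}
    (hT : ∀ i, T (b i) = μ i • b i) (v w : E) :
    ⟪T v, w⟫ = ∑ i, μ i * (⟪b i, v⟫ * ⟪b i, w⟫) := by
  conv_lhs => rw [← b.sum_repr' v]
  simp only [map_sum, map_smul, hT, sum_inner, real_inner_smul_left]
  exact Finset.sum_congr rfl fun i _ => by ring

lemma inner_map_comm_of_eigenbasis (b : OrthonormalBasis ι ℝ E) {T : E →L[ℝ] E} {μ : ι → ℝ}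
    (hT : ∀ i, T (b i) = μ i • b i) (v w : E) : ⟪T v, w⟫ = ⟪v, T w⟫ := by
  rw [real_inner_comm (T w) v, inner_map_eq_sum_eigenbasis b hT,
    inner_map_eq_sum_eigenbasis b hT]
  exact Finset.sum_congr rfl fun i _ => by ring

lemma mul_norm_sq_le_inner_map (b : OrthonormalBasis ι ℝ E) {T : E →L[ℝ] E} {μ : ι → ℝ}
    (hT : ∀ i, T (b i) = μ i • b i) {c : ℝ} {v : E} (h : ∀ i, ⟪b i, v⟫ ≠ 0 → c ≤ μ i) :
    c * ‖v‖ ^ 2 ≤ ⟪T v, v⟫ := by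
  rw [inner_map_eq_sum_eigenbasis b hT, ← b.sum_sq_inner_right v, Finset.mul_sum]
  refine Finset.sum_le_sum fun i _ => ?_
  by_cases hi : ⟪b i, v⟫ = 0
  · simp [hi]
  · nlinarith [h i hi, sq_nonneg ⟪b i, v⟫]

lemma inner_map_le_mul_norm_sq (b : OrthonormalBasis ι ℝ E) {T : E →L[ℝ] E} {μ : ι → ℝ}
    (hT : ∀ i, T (b i) = μ i • b i) {c : ℝ} {v : E} (h : ∀ i, ⟪b i, v⟫ ≠ 0 → μ i ≤ c) :
    ⟪T v, v⟫ ≤ c * ‖v‖ ^ 2 := by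
  rw [inner_map_eq_sum_eigenbasis b hT, ← b.sum_sq_inner_right v, Finset.mul_sum]
  refine Finset.sum_le_sum fun i _ => ?_
  by_cases hi : ⟪b i, v⟫ = 0
  · simp [hi]
  · nlinarith [h i hi, sq_nonneg ⟪b i, v⟫]

lemma abs_inner_map_sub_inner_map_le (S T : E →L[ℝ] E) (v : E) :
    |⟪S v, v⟫ - ⟪T v, v⟫| ≤ ‖S - T‖ * ‖v‖ ^ 2 := by
  rw [← inner_sub_left, ← sub_apply]
  calc _ ≤ ‖(S - T) v‖ * ‖v‖ := abs_real_inner_le_norm _ _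
    _ ≤ (‖S - T‖ * ‖v‖) * ‖v‖ := by gcongr; exact (S - T).le_opNorm v
    _ = _ := by ring

end Spectral

section OrderedSpectrum

variable {n : ℕ} {E : Type*} [NormedAddCommGroup E] [InnerProductSpace ℝ E]

lemma eigenvalue_zero_le_add_norm_sub (hn : 2 ≤ n) (b b' : OrthonormalBasis (Fin n) ℝ E)
    {S T : E →L[ℝ] E} {μ ν : Fin n → ℝ} (hμ : Monotone μ)
    (hS : ∀ i, S (b i) = μ i • b i) (hT : ∀ i, T (b' i) = ν i • b' i) :
    μ ⟨0, by omega⟩ ≤ ν ⟨0, by omega⟩ + ‖S - T‖ := by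
  have h1 := mul_norm_sq_le_inner_map b hS (c := μ ⟨0, by omega⟩) (v := b' ⟨0, by omega⟩)
    fun i _ => hμ (Fin.mk_le_of_le_val (Nat.zero_le _))
  have h2 := abs_le.1 (abs_inner_map_sub_inner_map_le S T (b' ⟨0, by omega⟩))
  rw [hT, real_inner_smul_left, real_inner_self_eq_norm_sq] at h2
  simp only [b'.norm_eq_one, one_pow, mul_one] at h1 h2
  linarith [h2.2]

lemma eigenvalue_one_le_add_norm_sub (hn : 2 ≤ n) (b b' : OrthonormalBasis (Fin n) ℝ E)
    {S T : E →L[ℝ] E} {μ ν : Fin n → ℝ} (hμ : Monotone μ) (hν : Monotone ν)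
    (hS : ∀ i, S (b i) = μ i • b i) (hT : ∀ i, T (b' i) = ν i • b' i) :
    μ ⟨1, by omega⟩ ≤ ν ⟨1, by omega⟩ + ‖S - T‖ := by
  set i0 : Fin n := ⟨0, by omega⟩
  set i1 : Fin n := ⟨1, by omega⟩
  have h01 : i0 ≠ i1 := by simp [i0, i1]
  obtain ⟨v, hv0, hv, hv'⟩ : ∃ v : E, v ≠ 0 ∧ ⟪b i0, v⟫ = 0 ∧
      ∀ i, ⟪b' i, v⟫ ≠ 0 → i ≤ i1 := by
    by_cases h : ⟪b i0, b' i0⟫ = 0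
    · refine ⟨b' i0, fun h0 => by simpa [h0] using b'.norm_eq_one i0, h, fun i hi => ?_⟩
      rw [b'.inner_eq_ite] at hi
      have : i = i0 := by by_contra h'; simp [h'] at hi
      rw [this]; exact Fin.mk_le_of_le_val (Nat.zero_le _)
    · refine ⟨⟪b i0, b' i1⟫ • b' i0 - ⟪b i0, b' i0⟫ • b' i1, fun h0 => h ?_, ?_, fun i hi => ?_⟩
      · have := congrArg (fun z => ⟪b' i1, z⟫) h0
        simpa [inner_sub_right, real_inner_smul_right, b'.inner_eq_ite, h01.symm] using this
      · rw [inner_sub_right, real_inner_smul_right, real_inner_smul_right]; ring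
      · by_contra hlt
        have h0 : i ≠ i0 := by rintro rfl; exact hlt (Fin.mk_le_of_le_val (Nat.zero_le _))
        have h1 : i ≠ i1 := by rintro rfl; exact hlt le_rfl
        exact hi (by simp [inner_sub_right, real_inner_smul_right, b'.inner_eq_ite, h0, h1])
  have h1 := mul_norm_sq_le_inner_map b hS (c := μ i1) (v := v) fun i hi => hμ <| by
    have : i ≠ i0 := by rintro rfl; exact hi hv
    rw [Fin.le_def]
    have : (i : ℕ) ≠ 0 := fun h => this (Fin.ext h)
    simp only [i1]; omega
  have h2 := inner_map_le_mul_norm_sq b' hT (c := ν i1) (v := v) fun i hi => hν (hv' i hi)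
  have h3 := abs_le.1 (abs_inner_map_sub_inner_map_le S T v)
  have hpos : 0 < ‖v‖ ^ 2 := by positivity
  refine le_of_mul_le_mul_right ?_ hpos
  linarith [h3.2]

/-- If the lowest eigenvalue is simple, the quadratic form splits along its eigenvector `u`, and
is bounded below by the second eigenvalue on the orthogonal complement of `u`. -/
lemma inner_map_split_of_lowest_eigenvector (hn : 2 ≤ n) (b : OrthonormalBasis (Fin n) ℝ E)
    {T : E →L[ℝ] E} {μ : Fin n → ℝ} (hμ : Monotone μ) (hT : ∀ i, T (b i) = μ i • b i)
    (hlt : μ ⟨0, by omega⟩ < μ ⟨1, by omega⟩) {u : E} (hu : ‖u‖ = 1)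
    (hTu : T u = μ ⟨0, by omega⟩ • u) (s : ℝ) {w : E} (hw : ⟪u, w⟫ = 0) :
    ⟪T (s • u + w), s • u + w⟫ = μ ⟨0, by omega⟩ * s ^ 2 + ⟪T w, w⟫ ∧
      μ ⟨1, by omega⟩ * ‖w‖ ^ 2 ≤ ⟪T w, w⟫ := by
  set i0 : Fin n := ⟨0, by omega⟩
  set i1 : Fin n := ⟨1, by omega⟩
  have hi1 : ∀ i, i ≠ i0 → i1 ≤ i := fun i hi => by
    rw [Fin.le_def]
    have : (i : ℕ) ≠ 0 := fun h => hi (Fin.ext h)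
    simp only [i1]; omega
  constructor
  · have h1 : ⟪T w, u⟫ = 0 := by
      rw [inner_map_comm_of_eigenbasis b hT, hTu, real_inner_smul_right, real_inner_comm, hw,
        mul_zero]
    simp only [map_add, map_smul, hTu, inner_add_left, inner_add_right, real_inner_smul_left,
      real_inner_smul_right, hw, h1, real_inner_self_eq_norm_sq, hu]
    ring
  · have hort : ∀ i, i ≠ i0 → ⟪b i, u⟫ = 0 := fun i hi => by
      have h := inner_map_comm_of_eigenbasis b hT (b i) u
      rw [hT, hTu, real_inner_smul_left, real_inner_smul_right] at h
      have : μ i0 < μ i := hlt.trans_le (hμ (hi1 i hi))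
      rcases mul_eq_zero.1 (show (μ i - μ i0) * ⟪b i, u⟫ = 0 by linarith) with h | h
      · linarith
      · exact h
    have hsum : u = ⟪b i0, u⟫ • b i0 := by
      conv_lhs => rw [← b.sum_repr' u]
      exact Finset.sum_eq_single i0 (fun i _ hi => by rw [hort i hi, zero_smul]) (by simp)
    refine mul_norm_sq_le_inner_map b hT fun i hi => hμ (hi1 i ?_)
    rintro rfl
    rw [hsum, real_inner_smul_left] at hw
    rcases mul_eq_zero.1 hw with h | h
    · rw [h, zero_smul] at hsum
      simp [hsum] at hu
    · exact hi h

end OrderedSpectrum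

section Lines

variable {E : Type*} [NormedAddCommGroup E]

lemma hasDerivAt_comp_line [NormedSpace ℝ E] {f : E → ℝ} (hf : ContDiff ℝ 2 f) (a v : E)
    (t : ℝ) :
    HasDerivAt (fun t : ℝ => f (a + t • v)) (fderiv ℝ f (a + t • v) v) t := by
  have h : HasDerivAt (fun t : ℝ => a + t • v) v t := by
    simpa using ((hasDerivAt_id t).smul_const v).const_add a
  exact ((hf.differentiable (by norm_num)) _).hasFDerivAt.comp_hasDerivAt t h

lemma hasDerivAt_fderiv_comp_line [NormedSpace ℝ E] {f : E → ℝ} (hf : ContDiff ℝ 2 f) (a v : E)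
    (t : ℝ) :
    HasDerivAt (fun t : ℝ => fderiv ℝ f (a + t • v) v)
      (fderiv ℝ (fderiv ℝ f) (a + t • v) v v) t := by
  have h : HasDerivAt (fun t : ℝ => a + t • v) v t := by
    simpa using ((hasDerivAt_id t).smul_const v).const_add a
  have hf' : ContDiff ℝ 1 (fderiv ℝ f) := hf.fderiv_right (by norm_num)
  have := ((hf'.differentiable (by norm_num)) (a + t • v)).hasFDerivAt.comp_hasDerivAt t h
  simpa using this.clm_apply (hasDerivAt_const t v)

end Lines

section Hessian

variable {n : ℕ} {V : EuclideanSpace ℝ (Fin n) → ℝ}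

lemma contDiff_gradient (hV : ContDiff ℝ 2 V) : ContDiff ℝ 1 (gradient V) :=
  (InnerProductSpace.toDual ℝ (EuclideanSpace ℝ (Fin n))).symm.contDiff.comp
    (hV.fderiv_right (by norm_num))

lemma continuous_hess (hV : ContDiff ℝ 2 V) : Continuous (hess V) :=
  (contDiff_gradient hV).continuous_fderiv (by norm_num)

lemma inner_hess (hV : ContDiff ℝ 2 V) (y v : EuclideanSpace ℝ (Fin n)) :
    ⟪hess V y v, v⟫ = fderiv ℝ (fderiv ℝ V) y v v := by
  have h1 := (((contDiff_gradient hV).differentiable (by norm_num)) y).hasFDerivAt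
  have h2 : HasFDerivAt (fun z => ⟪gradient V z, v⟫) _ y := h1.inner ℝ (hasFDerivAt_const v y)
  have hf' : ContDiff ℝ 1 (fderiv ℝ V) := hV.fderiv_right (by norm_num)
  have h3 := ((hf'.differentiable (by norm_num)) y).hasFDerivAt.clm_apply (hasFDerivAt_const v y)
  have h4 : (fun z => ⟪gradient V z, v⟫) = fun z => fderiv ℝ V z v := by
    funext z; simp [gradient]
  rw [h4] at h2
  simpa [hess] using DFunLike.congr_fun (h2.unique h3) v

end Hessian

section Penalty

variable {E : Type*} [NormedAddCommGroup E] [NormedSpace ℝ E]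

/-- A nonnegative convex function vanishing at `x` which is uniformly convex at distance at least
`ε` from `x` grows at least linearly at distance at least `3ε`. -/
lemma linear_growth_of_convexOn {q : E → ℝ} (hconv : ConvexOn ℝ Set.univ q)
    (hC2 : ContDiff ℝ 2 q) (hnn : ∀ y, 0 ≤ q y) {x : E} (hx : q x = 0) {ε c : ℝ} (hε : 0 < ε)
    (hstrong : ∀ y, ε ≤ ‖x - y‖ → ∀ v, c * ‖v‖ ^ 2 ≤ iteratedFDeriv ℝ 2 q y ![v, v])
    {y : E} (hy : 3 * ε ≤ ‖y - x‖) : c * ε / 3 * ‖y - x‖ ≤ q y := by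
  set t := ‖y - x‖ with ht
  have htpos : 0 < t := by linarith
  set e : E := t⁻¹ • (y - x) with he
  have hnorm : ‖e‖ = 1 := by
    rw [he, norm_smul, ← ht, Real.norm_of_nonneg (by positivity)]; field_simp
  have hye : x + t • e = y := by
    rw [he, smul_smul, mul_inv_cancel₀ htpos.ne', one_smul]; abel
  have hscale : ∀ r s : ℝ, 0 ≤ r → r ≤ s → 0 < s → s * q (x + r • e) ≤ r * q (x + s • e) := by
    intro r s hr hrs hs
    have h := hconv.2 (Set.mem_univ x) (Set.mem_univ (x + s • e))
      (show 0 ≤ 1 - r / s by rw [sub_nonneg, div_le_one hs]; exact hrs)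
      (show 0 ≤ r / s by positivity) (by ring)
    have hpt : (1 - r / s) • x + (r / s) • (x + s • e) = x + r • e := by
      rw [smul_add, smul_smul, div_mul_cancel₀ _ hs.ne']; module
    rw [hpt, hx, smul_zero, zero_add, smul_eq_mul] at h
    calc s * q (x + r • e) ≤ s * (r / s * q (x + s • e)) := by gcongr
      _ = r * q (x + s • e) := by field_simp
  have hg : ConvexOn ℝ (Set.Ici ε) fun r : ℝ => q (x + r • e) - c / 2 * r ^ 2 := by
    have h1 : ∀ r : ℝ, HasDerivAt (fun r : ℝ => q (x + r • e) - c / 2 * r ^ 2)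
        (fderiv ℝ q (x + r • e) e - c * r) r := fun r =>
      ((hasDerivAt_comp_line hC2 x e r).sub ((hasDerivAt_pow 2 r).const_mul (c / 2))).congr_deriv
        (by norm_num; ring)
    have h2 : ∀ r : ℝ, HasDerivAt (fun r : ℝ => fderiv ℝ q (x + r • e) e - c * r)
        (fderiv ℝ (fderiv ℝ q) (x + r • e) e e - c) r := fun r =>
      ((hasDerivAt_fderiv_comp_line hC2 x e r).sub ((hasDerivAt_id r).const_mul c)).congr_deriv
        (by ring)
    refine convexOn_of_hasDerivWithinAt2_nonneg (convex_Ici ε)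
      (fun r _ => (h1 r).continuousAt.continuousWithinAt)
      (fun r _ => (h1 r).hasDerivWithinAt) (fun r _ => (h2 r).hasDerivWithinAt) fun r hr => ?_
    have hr' : ε ≤ r := interior_subset hr
    have h := hstrong (x + r • e) (by
      rw [sub_add_cancel_left, norm_neg, norm_smul, hnorm, mul_one,
        Real.norm_of_nonneg (hε.le.trans hr')]; exact hr') e
    rw [iteratedFDeriv_two_apply, hnorm] at h
    simp at h
    linarith
  have hmid := hg.2 (Set.mem_Ici.2 le_rfl) (Set.mem_Ici.2 (show ε ≤ 3 * ε by linarith))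
    (show (0 : ℝ) ≤ 1 / 2 by norm_num) (show (0 : ℝ) ≤ 1 / 2 by norm_num) (by norm_num)
  simp only [smul_eq_mul] at hmid
  rw [show 1 / 2 * ε + 1 / 2 * (3 * ε) = 2 * ε by ring] at hmid
  have h12 := hscale ε (2 * ε) hε.le (by linarith) (by linarith)
  have h12' : 2 * q (x + ε • e) ≤ q (x + (2 * ε) • e) := by
    refine le_of_mul_le_mul_left ?_ hε; linarith
  have h3 : c * ε ^ 2 ≤ q (x + (3 * ε) • e) := by
    nlinarith [hnn (x + ε • e)]
  have h3t := hscale (3 * ε) t (by linarith) hy htpos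
  rw [hye] at h3t
  have : (3 * ε) * (c * ε / 3 * t) ≤ (3 * ε) * q y := by
    calc (3 * ε) * (c * ε / 3 * t) = t * (c * ε ^ 2) := by ring
      _ ≤ t * q (x + (3 * ε) • e) := by gcongr
      _ ≤ _ := h3t
  exact le_of_mul_le_mul_left this (by linarith)

end Penalty

section Projection

variable {E : Type*} [NormedAddCommGroup E] [InnerProductSpace ℝ E]

lemma norm_sub_inner_smul_sq {u : E} (hu : ‖u‖ = 1) (z : E) :
    ‖z - ⟪u, z⟫ • u‖ ^ 2 = ‖z‖ ^ 2 - ⟪u, z⟫ ^ 2 := by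
  rw [norm_sub_sq_real, norm_smul, hu, real_inner_smul_right, real_inner_comm, mul_one,
    Real.norm_eq_abs, sq_abs]
  ring

lemma norm_sub_inner_smul_le {u : E} (hu : ‖u‖ = 1) (z : E) : ‖z - ⟪u, z⟫ • u‖ ≤ ‖z‖ :=
  le_of_sq_le_sq (by nlinarith [norm_sub_inner_smul_sq hu z, sq_nonneg ⟪u, z⟫]) (norm_nonneg z)

lemma norm_inner_smul_le {u : E} (hu : ‖u‖ = 1) (z : E) : ‖⟪u, z⟫ • u‖ ≤ ‖z‖ := by
  rw [norm_smul, hu, mul_one, Real.norm_eq_abs]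
  simpa [hu] using abs_real_inner_le_norm u z

/-- Positivity of the second derivative of the unpenalized part of `Wtilde` in direction `v`, when
the Hessians at the three evaluation points are close to a common `T` with one negative
eigenvalue. -/
lemma wtilde_second_derivative_pos {n : ℕ} (hn : 2 ≤ n) (b : OrthonormalBasis (Fin n) ℝ E)
    {T A B C : E →L[ℝ] E} {μ : Fin n → ℝ} (hμ : Monotone μ) (hT : ∀ i, T (b i) = μ i • b i)
    {u : E} (hu : ‖u‖ = 1) (hTu : T u = μ ⟨0, by omega⟩ • u) {α β m η : ℝ} (hab : 1 < α + β)
    (hm0 : m ≤ -μ ⟨0, by omega⟩) (hm1 : m ≤ μ ⟨1, by omega⟩) (hm : 0 < m)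
    (hA : ‖A - T‖ ≤ η) (hB : ‖B - T‖ ≤ η) (hC : ‖C - T‖ ≤ η)
    (hη0 : (|1 - α| + |α| + |β|) * η < m * (α + β - 1))
    (hη1 : (|1 - α| + |α| + |β|) * η < m) {v : E} (hv : v ≠ 0) :
    0 < (1 - α) * ⟪A v, v⟫ + α * ⟪B (v - ⟪u, v⟫ • u), v - ⟪u, v⟫ • u⟫
      - β * ⟪C (⟪u, v⟫ • u), ⟪u, v⟫ • u⟫ := by
  set s := ⟪u, v⟫ with hs
  set w := v - s • u with hw
  have huw : ⟪u, w⟫ = 0 := by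
    rw [hw, inner_sub_right, real_inner_smul_right, real_inner_self_eq_norm_sq, hu, ← hs]; ring
  obtain ⟨hsplit, hQ⟩ := inner_map_split_of_lowest_eigenvector hn b hμ hT (by linarith) hu hTu s huw
  obtain ⟨hsplit0, -⟩ := inner_map_split_of_lowest_eigenvector hn b hμ hT (by linarith) hu hTu s
    (inner_zero_right u)
  rw [show s • u + w = v by rw [hw]; abel] at hsplit
  simp only [add_zero, map_zero, inner_zero_left] at hsplit0
  have hη : 0 ≤ η := (norm_nonneg _).trans hA
  have hpert : ∀ (a : ℝ) (S : E →L[ℝ] E) (z : E), ‖S - T‖ ≤ η → ‖z‖ ≤ ‖v‖ →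
      |a * ⟪S z, z⟫ - a * ⟪T z, z⟫| ≤ |a| * (η * ‖v‖ ^ 2) := by
    intro a S z hS hz
    rw [← mul_sub, abs_mul]
    gcongr
    exact (abs_inner_map_sub_inner_map_le S T z).trans (by gcongr)
  have e1 := abs_le.1 (hpert (1 - α) A v hA le_rfl)
  have e2 := abs_le.1 (hpert α B w hB (norm_sub_inner_smul_le hu v))
  have e3 := abs_le.1 (hpert β C (s • u) hC (norm_inner_smul_le hu v))
  rw [hsplit] at e1
  rw [hsplit0] at e3
  have hnorm : ‖v‖ ^ 2 = s ^ 2 + ‖w‖ ^ 2 := by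
    have := norm_sub_inner_smul_sq hu v
    rw [← hs, ← hw] at this
    linarith
  have hvpos : 0 < ‖v‖ ^ 2 := by positivity
  have k1 : 0 ≤ (-μ ⟨0, by omega⟩ - m) * (α + β - 1) * s ^ 2 :=
    mul_nonneg (mul_nonneg (by linarith) (by linarith)) (sq_nonneg s)
  have k2 : 0 ≤ (μ ⟨1, by omega⟩ - m) * ‖w‖ ^ 2 := mul_nonneg (by linarith) (sq_nonneg _)
  have k3 : (|1 - α| + |α| + |β|) * η * ‖v‖ ^ 2 < m * (α + β - 1) * s ^ 2 + m * ‖w‖ ^ 2 := by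
    calc _ < min (m * (α + β - 1)) m * ‖v‖ ^ 2 := by gcongr; exact lt_min hη0 hη1
      _ = min (m * (α + β - 1)) m * s ^ 2 + min (m * (α + β - 1)) m * ‖w‖ ^ 2 := by
        rw [hnorm]; ring
      _ ≤ _ := by gcongr; exacts [min_le_left _ _, min_le_right _ _]
  linarith [e1.1, e2.1, e3.2]

end Projection

section Auxiliary

variable {n : ℕ} {V : EuclideanSpace ℝ (Fin n) → ℝ}

/-- The unpenalized part of `Wtilde` is strictly midpoint convex on a ball around `x` on which the
Hessian of `V` is close to its value at `x`. -/
lemma wtilde_unpenalized_midpoint_lt (hn : 2 ≤ n) (hV : ContDiff ℝ 2 V)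
    {x u : EuclideanSpace ℝ (Fin n)} (b : OrthonormalBasis (Fin n) ℝ (EuclideanSpace ℝ (Fin n)))
    {μ : Fin n → ℝ} (hμ : Monotone μ) (hT : ∀ i, hess V x (b i) = μ i • b i)
    (hu : ‖u‖ = 1) (hTu : hess V x u = μ ⟨0, by omega⟩ • u) {α β m η R : ℝ} (hab : 1 < α + β)
    (hm0 : m ≤ -μ ⟨0, by omega⟩) (hm1 : m ≤ μ ⟨1, by omega⟩) (hm : 0 < m)
    (hη0 : (|1 - α| + |α| + |β|) * η < m * (α + β - 1))
    (hη1 : (|1 - α| + |α| + |β|) * η < m)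
    (hR : ∀ z, ‖z - x‖ ≤ R → ‖hess V z - hess V x‖ ≤ η)
    (p : EuclideanSpace ℝ (Fin n) → EuclideanSpace ℝ (Fin n) → ℝ)
    {y z : EuclideanSpace ℝ (Fin n)} (hy : ‖y - x‖ ≤ R) (hz : ‖z - x‖ ≤ R) (hyz : y ≠ z) :
    Wtilde V p α β 0 x u ((1 / 2 : ℝ) • y + (1 / 2 : ℝ) • z) <
      1 / 2 * Wtilde V p α β 0 x u y + 1 / 2 * Wtilde V p α β 0 x u z := by
  set v := z - y with hv
  have hv0 : v ≠ 0 := sub_ne_zero.2 hyz.symm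
  set y' := y - ⟪u, y - x⟫ • u with hy'
  set v' := v - ⟪u, v⟫ • u with hv'
  set y'' := x + ⟪u, y - x⟫ • u with hy''
  set v'' := ⟪u, v⟫ • u with hv''
  have hin : ∀ t : ℝ, ⟪u, y + t • v - x⟫ = ⟪u, y - x⟫ + t * ⟪u, v⟫ := fun t => by
    rw [add_sub_right_comm, inner_add_right, real_inner_smul_right]
  have hl' : ∀ t : ℝ, y + t • v - ⟪u, y + t • v - x⟫ • u = y' + t • v' := fun t => by
    rw [hin, hy', hv']; module
  have hl'' : ∀ t : ℝ, x + ⟪u, y + t • v - x⟫ • u = y'' + t • v'' := fun t => by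
    rw [hin, hy'', hv'']; module
  have hF : ∀ t : ℝ, Wtilde V p α β 0 x u (y + t • v) =
      (1 - α) * V (y + t • v) + α * V (y' + t • v') - β * V (y'' + t • v'') := fun t => by
    rw [Wtilde, hl', hl'', zero_mul, add_zero]
  have hd1 : ∀ t : ℝ, HasDerivAt (fun t : ℝ => Wtilde V p α β 0 x u (y + t • v))
      ((1 - α) * fderiv ℝ V (y + t • v) v + α * fderiv ℝ V (y' + t • v') v'
        - β * fderiv ℝ V (y'' + t • v'') v'') t := fun t => by
    simp only [hF]
    exact (((hasDerivAt_comp_line hV y v t).const_mul _).add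
      ((hasDerivAt_comp_line hV y' v' t).const_mul _)).sub
      ((hasDerivAt_comp_line hV y'' v'' t).const_mul _)
  have hd2 : ∀ t : ℝ, HasDerivAt (fun t : ℝ => (1 - α) * fderiv ℝ V (y + t • v) v
        + α * fderiv ℝ V (y' + t • v') v' - β * fderiv ℝ V (y'' + t • v'') v'')
      ((1 - α) * ⟪hess V (y + t • v) v, v⟫ + α * ⟪hess V (y' + t • v') v', v'⟫
        - β * ⟪hess V (y'' + t • v'') v'', v''⟫) t := fun t => by
    simp only [inner_hess hV]
    exact (((hasDerivAt_fderiv_comp_line hV y v t).const_mul _).add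
      ((hasDerivAt_fderiv_comp_line hV y' v' t).const_mul _)).sub
      ((hasDerivAt_fderiv_comp_line hV y'' v'' t).const_mul _)
  have hconv : StrictConvexOn ℝ (Set.Icc 0 1)
      fun t : ℝ => Wtilde V p α β 0 x u (y + t • v) := by
    refine strictConvexOn_of_deriv2_pos' (convex_Icc 0 1)
      (fun t _ => (hd1 t).continuousAt.continuousWithinAt) fun t ht => ?_
    rw [Function.iterate_succ, Function.iterate_one, Function.comp_apply,
      show deriv (fun t : ℝ => Wtilde V p α β 0 x u (y + t • v)) = _ from
        funext fun t => (hd1 t).deriv, (hd2 t).deriv]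
    have hball : ‖y + t • v - x‖ ≤ R := by
      have h := (convex_closedBall x R) (mem_closedBall_iff_norm.2 hy)
        (mem_closedBall_iff_norm.2 hz) (sub_nonneg.2 ht.2) ht.1 (by ring)
      rw [mem_closedBall_iff_norm] at h
      rwa [show (1 - t) • y + t • z = y + t • v by rw [hv]; module] at h
    refine wtilde_second_derivative_pos hn b hμ hT hu hTu hab hm0 hm1 hm (hR _ hball)
      (hR _ ?_) (hR _ ?_) hη0 hη1 hv0
    · rw [← hl', sub_right_comm]
      exact (norm_sub_inner_smul_le hu _).trans hball
    · rw [← hl'', add_sub_cancel_left]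
      exact (norm_inner_smul_le hu _).trans hball
  have h := hconv.2 (Set.left_mem_Icc.2 zero_le_one) (Set.right_mem_Icc.2 zero_le_one)
    zero_ne_one (show (0 : ℝ) < 1 / 2 by norm_num) (show (0 : ℝ) < 1 / 2 by norm_num) (by norm_num)
  simp only [smul_eq_mul, mul_zero, zero_add, mul_one, zero_smul, add_zero, one_smul] at h
  rw [show y + v = z by rw [hv]; abel] at h
  rwa [show y + (1 / 2 : ℝ) • v = (1 / 2 : ℝ) • y + (1 / 2 : ℝ) • z by rw [hv]; module] at h

lemma neg_mul_norm_le_wtilde_sub {L : ℝ} (hL : ∀ a b, |V a - V b| ≤ L * ‖a - b‖) (hL0 : 0 ≤ L)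
    (p : EuclideanSpace ℝ (Fin n) → EuclideanSpace ℝ (Fin n) → ℝ) (α β : ℝ)
    {x u : EuclideanSpace ℝ (Fin n)} (hu : ‖u‖ = 1) (y : EuclideanSpace ℝ (Fin n)) :
    -((|1 - α| + |α| + |β|) * L * ‖y - x‖) ≤ Wtilde V p α β 0 x u y - Wtilde V p α β 0 x u x := by
  have hb : ∀ (a : ℝ) (z : EuclideanSpace ℝ (Fin n)), ‖z - x‖ ≤ ‖y - x‖ →
      |a * V z - a * V x| ≤ |a| * (L * ‖y - x‖) := fun a z hz => by
    rw [← mul_sub, abs_mul]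
    gcongr
    exact (hL z x).trans (by gcongr)
  have e1 := abs_le.1 (hb (1 - α) y le_rfl)
  have e2 := abs_le.1 (hb α (y - ⟪u, y - x⟫ • u) (by
    rw [sub_right_comm]; exact norm_sub_inner_smul_le hu _))
  have e3 := abs_le.1 (hb β (x + ⟪u, y - x⟫ • u) (by
    rw [add_sub_cancel_left]; exact norm_inner_smul_le hu _))
  simp only [Wtilde, sub_self, inner_zero_right, zero_smul, sub_zero, add_zero, zero_mul]
  linarith [e1.1, e2.1, e3.2]

lemma wtilde_eq_add (p : EuclideanSpace ℝ (Fin n) → EuclideanSpace ℝ (Fin n) → ℝ)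
    (α β ρ : ℝ) (x u y : EuclideanSpace ℝ (Fin n)) :
    Wtilde V p α β ρ x u y = Wtilde V p α β 0 x u y + ρ * p x y := by
  simp [Wtilde]

end Auxiliary

/-- Theorem 3.3: under the assumptions on `V` (C³, Lipschitz, uniformly
bounded Hessian) and on the penalty `p` (convex C² in `y`, vanishing Hessian only on the
diagonal, nonnegative and zero only on the diagonal, uniformly strongly convex away from the
diagonal), for any nonempty compact `Ω₁′ ⊆ Ω₁` and `α + β > 1`, there is `ρ̄ > 0` such that
for all `ρ > ρ̄`, all `x ∈ Ω₁′` and every unit eigenvector `u` of `∇²V(x)` for `λ₁(x)`, the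
function `y ↦ W̃_ρ(y; x, u)` has a unique global minimizer, and it lies in `Ω₁`. -/
theorem stmt_13 {n : ℕ} (hn : 2 ≤ n)
    (V : EuclideanSpace ℝ (Fin n) → ℝ)
    (hV : ContDiff ℝ 3 V)
    (hVLip : ∃ L : ℝ, ∀ a b : EuclideanSpace ℝ (Fin n), |V a - V b| ≤ L * ‖a - b‖)
    (lamL lamU : ℝ)
    (hHessBdd : ∀ x v : EuclideanSpace ℝ (Fin n),
      lamL * ‖v‖ ^ 2 ≤ ⟪hess V x v, v⟫ ∧ ⟪hess V x v, v⟫ ≤ lamU * ‖v‖ ^ 2)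
    (lam : Fin n → EuclideanSpace ℝ (Fin n) → ℝ)
    (hlamMono : ∀ x : EuclideanSpace ℝ (Fin n), Monotone fun i => lam i x)
    (hlamEig : ∀ x : EuclideanSpace ℝ (Fin n), ∃ w : Fin n → EuclideanSpace ℝ (Fin n),
      Orthonormal ℝ w ∧ ∀ i, hess V x (w i) = lam i x • w i)
    (p : EuclideanSpace ℝ (Fin n) → EuclideanSpace ℝ (Fin n) → ℝ)
    (hpConv : ∀ x, ConvexOn ℝ Set.univ (p x))
    (hpC2 : ∀ x, ContDiff ℝ 2 (p x))
    (hpHess0 : ∀ x y, iteratedFDeriv ℝ 2 (p x) y = 0 ↔ y = x)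
    (hpNonneg : ∀ x y, 0 ≤ p x y)
    (hpZero : ∀ x y, p x y = 0 ↔ x = y)
    (hpStrong : ∀ ε : ℝ, 0 < ε → ∃ lamε : ℝ, 0 < lamε ∧
      ∀ x y : EuclideanSpace ℝ (Fin n), ε ≤ ‖x - y‖ →
        ∀ v, lamε * ‖v‖ ^ 2 ≤ iteratedFDeriv ℝ 2 (p x) y ![v, v])
    (α β : ℝ) (hab : α + β > 1)
    (Ω₁' : Set (EuclideanSpace ℝ (Fin n)))
    (hΩ'comp : IsCompact Ω₁') (hΩ'ne : Ω₁'.Nonempty) (hΩ'sub : Ω₁' ⊆ Omega1 hn lam) :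
    ∃ ρbar : ℝ, 0 < ρbar ∧ ∀ ρ : ℝ, ρ > ρbar → ∀ x ∈ Ω₁', ∀ u : EuclideanSpace ℝ (Fin n),
      ‖u‖ = 1 → hess V x u = lam ⟨0, by omega⟩ x • u →
      ∃ xhat : EuclideanSpace ℝ (Fin n),
        (∀ y, Wtilde V p α β ρ x u xhat ≤ Wtilde V p α β ρ x u y) ∧
        xhat ∈ Omega1 hn lam ∧
        ∀ z : EuclideanSpace ℝ (Fin n),
          (∀ y, Wtilde V p α β ρ x u z ≤ Wtilde V p α β ρ x u y) → z = xhat := by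
  have hV2 : ContDiff ℝ 2 V := hV.of_le (by norm_num)
  set i0 : Fin n := ⟨0, by omega⟩ with hi0
  set i1 : Fin n := ⟨1, by omega⟩ with hi1
  have heig : ∀ x, ∃ b : OrthonormalBasis (Fin n) ℝ (EuclideanSpace ℝ (Fin n)),
      ∀ i, hess V x (b i) = lam i x • b i := fun x => by
    obtain ⟨w, hw, hHw⟩ := hlamEig x
    obtain ⟨b, hb⟩ := Orthonormal.exists_orthonormalBasis_extension_of_card_eq
      (ι := Fin n) (𝕜 := ℝ) (by simp) (v := w) (s := Set.univ)
      (hw.comp _ Subtype.val_injective)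
    exact ⟨b, fun i => by rw [hb i (Set.mem_univ i), hHw]⟩
  choose b hb using heig
  have hlam0 : ∀ x y, lam i0 x ≤ lam i0 y + ‖hess V x - hess V y‖ := fun x y =>
    eigenvalue_zero_le_add_norm_sub hn (b x) (b y) (hlamMono x) (hb x) (hb y)
  have hlam1 : ∀ x y, lam i1 x ≤ lam i1 y + ‖hess V x - hess V y‖ := fun x y =>
    eigenvalue_one_le_add_norm_sub hn (b x) (b y) (hlamMono x) (hlamMono y) (hb x) (hb y)
  have hcont : ∀ f : EuclideanSpace ℝ (Fin n) → ℝ,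
      (∀ x y, f x ≤ f y + ‖hess V x - hess V y‖) → Continuous f := fun f hf => by
    refine continuous_iff_continuousAt.2 fun x => ?_
    have hH : Filter.Tendsto (fun y => ‖hess V y - hess V x‖) (nhds x) (nhds 0) :=
      tendsto_iff_norm_sub_tendsto_zero.1 (continuous_hess hV2).continuousAt
    refine tendsto_iff_norm_sub_tendsto_zero.2 (squeeze_zero (fun _ => norm_nonneg _) ?_ hH)
    intro y
    rw [Real.norm_eq_abs, abs_le]
    have h := hf x y
    rw [norm_sub_rev] at h
    constructor <;> linarith [hf y x]
  obtain ⟨x₀, hx₀, hmin⟩ := hΩ'comp.exists_isMinOn hΩ'ne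
    ((hcont _ hlam0).neg.min (hcont _ hlam1)).continuousOn
  set m := min (-lam i0 x₀) (lam i1 x₀) with hm_def
  have hm : 0 < m := lt_min (neg_pos.2 (hΩ'sub hx₀).1) (hΩ'sub hx₀).2
  have hmle : ∀ x ∈ Ω₁', m ≤ min (-lam i0 x) (lam i1 x) := fun x hx => hmin hx
  set K := |1 - α| + |α| + |β| with hK
  have hK0 : 0 ≤ K := by positivity
  set c := min (m * (α + β - 1)) m with hc_def
  have hc : 0 < c := lt_min (mul_pos hm (by linarith)) hm
  set η := c / (2 * (K + 1)) with hη_def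
  have hη : 0 < η := by positivity
  have hKη : (K + 1) * η = c / 2 := by rw [hη_def]; field_simp
  have hηc : K * η < c := by linarith
  have hηm : η < m := by nlinarith [min_le_right (m * (α + β - 1)) m]
  have hunif := hΩ'comp.uniformContinuousAt_of_continuousAt (hess V)
    (fun x _ => (continuous_hess hV2).continuousAt) (Metric.dist_mem_uniformity hη)
  obtain ⟨δ, hδ, hδH⟩ := Metric.mem_uniformity_dist.1 hunif
  set ε := δ / 6 with hε_def
  have hε : 0 < ε := by positivity
  have hH : ∀ x ∈ Ω₁', ∀ z, ‖z - x‖ ≤ 3 * ε → ‖hess V z - hess V x‖ < η := fun x hx z hz => by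
    have h := @hδH x z (by rw [dist_comm, dist_eq_norm]; linarith) hx
    rwa [Set.mem_ofPred_eq, dist_comm, dist_eq_norm] at h
  obtain ⟨κ, hκ, hstrong⟩ := hpStrong ε hε
  obtain ⟨L, hL⟩ := hVLip
  have hL' : ∀ a b, |V a - V b| ≤ |L| * ‖a - b‖ := fun a b =>
    (hL a b).trans (by gcongr; exact le_abs_self L)
  set g := κ * ε / 3 with hg_def
  have hg : 0 < g := by positivity
  refine ⟨K * |L| / g + 1, by positivity, fun ρ hρ x hx u hu hHu => ?_⟩
  have hρ' : K * |L| < ρ * g := by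
    rw [← div_lt_iff₀ hg]; linarith
  have hρ0 : 0 < ρ := lt_of_le_of_lt (by positivity) hρ
  have hpx : p x x = 0 := (hpZero x x).2 rfl
  have hfar : ∀ y, 3 * ε ≤ ‖y - x‖ → Wtilde V p α β ρ x u x < Wtilde V p α β ρ x u y := by
    intro y hy
    have h1 := neg_mul_norm_le_wtilde_sub hL' (abs_nonneg L) p α β (x := x) hu y
    have h2 := linear_growth_of_convexOn (hpConv x) (hpC2 x) (hpNonneg x) hpx hε (hstrong x) hy
    have h3 : 0 < ‖y - x‖ := by linarith
    rw [wtilde_eq_add p α β ρ x u x, wtilde_eq_add p α β ρ x u y, hpx]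
    have h4 := mul_le_mul_of_nonneg_left h2 hρ0.le
    have h5 := mul_lt_mul_of_pos_right hρ' h3
    rw [← hg_def, ← mul_assoc] at h4
    rw [← hK] at h1
    linarith
  have hVc : Continuous V := hV.continuous
  have hpc : Continuous (p x) := (hpC2 x).continuous
  have hWc : Continuous fun y => Wtilde V p α β ρ x u y := by
    unfold Wtilde; fun_prop
  obtain ⟨xhat, hxhat, hmin'⟩ := (isCompact_closedBall x (3 * ε)).exists_isMinOn
    ⟨x, Metric.mem_closedBall_self (by linarith)⟩ hWc.continuousOn
  rw [mem_closedBall_iff_norm] at hxhat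
  have hglob : ∀ y, Wtilde V p α β ρ x u xhat ≤ Wtilde V p α β ρ x u y := by
    intro y
    rcases le_total ‖y - x‖ (3 * ε) with hy | hy
    · exact hmin' (mem_closedBall_iff_norm.2 hy)
    · exact (hmin' (Metric.mem_closedBall_self (by linarith))).trans (hfar y hy).le
  have hm0 := (hmle x hx).trans (min_le_left _ _)
  have hm1 := (hmle x hx).trans (min_le_right _ _)
  refine ⟨xhat, hglob, ⟨?_, ?_⟩, fun z hz => ?_⟩
  · linarith [hlam0 xhat x, hH x hx xhat hxhat]
  · have h := hlam1 x xhat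
    rw [norm_sub_rev] at h
    linarith [hH x hx xhat hxhat]
  · by_contra hne
    have hzx : ‖z - x‖ ≤ 3 * ε := by
      by_contra! h
      exact absurd (hz x) (not_le.2 (hfar z h.le))
    have h1 := wtilde_unpenalized_midpoint_lt hn hV2 (b x) (hlamMono x) (hb x) hu hHu hab hm0 hm1
      hm (hηc.trans_le (min_le_left _ _)) (hηc.trans_le (min_le_right _ _))
      (fun w hw => (hH x hx w hw).le) p hzx hxhat hne
    have h2 := (hpConv x).2 (Set.mem_univ z) (Set.mem_univ xhat)
      (show (0 : ℝ) ≤ 1 / 2 by norm_num) (show (0 : ℝ) ≤ 1 / 2 by norm_num) (by norm_num)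
    have h3 := mul_le_mul_of_nonneg_left h2 hρ0.le
    have h4 := hz xhat
    have h5 := hglob ((1 / 2 : ℝ) • z + (1 / 2 : ℝ) • xhat)
    simp only [smul_eq_mul] at h3
    rw [wtilde_eq_add p α β ρ x u z, wtilde_eq_add p α β ρ x u xhat] at h4
    rw [wtilde_eq_add p α β ρ x u xhat, wtilde_eq_add p α β ρ x u (_ + _)] at h5
    linarith
end

section
/- (Theorem 3.1(1) of the paper.) Assume V : ℝ^d → ℝ is three times continuously differentiable and Lipschitz continuous, its Hessian is uniformly bounded (λ̄_L·‖v‖² ≤ (∇²V(x))(v,v) ≤ λ̄_U·‖v‖² for all x, v), the set 𝒮₁ of non-degenerate index-1 saddle points of V (points x* with ∇V(x*) = 0 and λ₁(x*) < 0 < λ₂(x*)) is nonempty and finite, and all stationary points of V are non-degenerate. Assume d(·,·) : ℝ^d × ℝ^d → ℝ satisfies: (a) for each x, y ↦ d(x,y) is convex and C², with ∇²_y d(x,y) = 0 iff y = x; (b) d(x,y) ≥ 0 with equality iff x = y; (c) for every ε > 0 there is λ̄_ε > 0 such that (∇²_y d(x,y))(v,v) ≥ λ̄_ε·‖v‖²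 whenever ‖x−y‖ ≥ ε. Let α, β ∈ ℝ with α + β > 1, and define W̃_ρ(y; x, u) := (1−α)·V(y) + α·V(y − ⟨u, y−x⟩·u) − β·V(x + ⟨u, y−x⟩·u) + ρ·d(x,y). Then there exists ρ̄ > 0 such that for every ρ ≥ ρ̄, every x* ∈ 𝒮₁, and every unit eigenvector u of ∇²V(x*) for λ₁(x*), the point x* is the unique global minimizer of y ↦ W̃_ρ(y; x*, u) over ℝ^d. -/
open scoped RealInnerProductSpace

/-- Coordinates of an operator that is diagonal in an orthonormal basis. -/
lemma inner_apply_eq_sum_of_eigenbasis {ι E : Type*} [Fintype ι] [NormedAddCommGroup E]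
    [InnerProductSpace ℝ E] (H : E →L[ℝ] E) (b : OrthonormalBasis ι ℝ E) (μ : ι → ℝ)
    (hb : ∀ i, H (b i) = μ i • b i) (v w : E) :
    ⟪H v, w⟫ = ∑ i, μ i * ⟪b i, v⟫ * ⟪b i, w⟫ := by
  conv_lhs => rw [← b.sum_repr' v]
  rw [map_sum, sum_inner]
  refine Finset.sum_congr rfl fun i _ => ?_
  rw [map_smul, hb, real_inner_smul_left, real_inner_smul_left]
  ring

/-- If `H` is diagonal in an orthonormal basis and every eigenvalue except `μ i₀` is at least
`c`, where `μ i₀ < c`, then `H ≥ c` on the orthogonal complement of any `μ i₀`-eigenvector. -/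
lemma mul_norm_sq_le_inner_of_orthogonal_eigenvector {ι E : Type*} [Fintype ι]
    [NormedAddCommGroup E] [InnerProductSpace ℝ E] (H : E →L[ℝ] E)
    (b : OrthonormalBasis ι ℝ E) (μ : ι → ℝ) (hb : ∀ i, H (b i) = μ i • b i) (i₀ : ι) {c : ℝ}
    (hc : μ i₀ < c) (hμ : ∀ i, i ≠ i₀ → c ≤ μ i) {u w : E} (hu : u ≠ 0)
    (hHu : H u = μ i₀ • u) (hw : ⟪u, w⟫ = 0) :
    c * ‖w‖ ^ 2 ≤ ⟪H w, w⟫ := by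
  classical
  have hui : ∀ i, i ≠ i₀ → ⟪b i, u⟫ = 0 := by
    intro i hi
    have h1 := inner_apply_eq_sum_of_eigenbasis H b μ hb u (b i)
    rw [hHu, real_inner_smul_left, Finset.sum_eq_single i] at h1
    · rw [real_inner_self_eq_norm_sq, b.norm_eq_one, real_inner_comm] at h1
      have h2 : (μ i - μ i₀) * ⟪b i, u⟫ = 0 := by linarith
      rcases mul_eq_zero.mp h2 with h3 | h3
      · linarith [hμ i hi]
      · exact h3
    · intro j _ hj
      rw [b.inner_eq_zero hj, mul_zero]
    · simp
  have hu0 : ⟪b i₀, u⟫ ≠ 0 := by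
    intro h0
    apply hu
    rw [← b.sum_repr' u]
    refine Finset.sum_eq_zero fun i _ => ?_
    by_cases hi : i = i₀
    · rw [hi, h0, zero_smul]
    · rw [hui i hi, zero_smul]
  have hw0 : ⟪b i₀, w⟫ = 0 := by
    rw [← b.sum_inner_mul_inner u w, Finset.sum_eq_single i₀] at hw
    · rw [real_inner_comm] at hw
      exact (mul_eq_zero.mp hw).resolve_left hu0
    · intro j _ hj
      rw [real_inner_comm, hui j hj, zero_mul]
    · simp
  rw [inner_apply_eq_sum_of_eigenbasis H b μ hb, ← b.sum_sq_inner_right w, Finset.mul_sum]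
  refine Finset.sum_le_sum fun i _ => ?_
  by_cases hi : i = i₀
  · simp [hi, hw0]
  · nlinarith [mul_le_mul_of_nonneg_right (hμ i hi) (sq_nonneg ⟪b i, w⟫)]

/-- Second-order Taylor expansion at a critical point with symmetric Hessian. -/
lemma exists_ball_abs_sub_quadratic_le {E : Type*} [NormedAddCommGroup E]
    [InnerProductSpace ℝ E] [CompleteSpace E] {V : E → ℝ} (hV : Differentiable ℝ V) {x : E}
    {H : E →L[ℝ] E} (hH : HasFDerivAt (gradient V) H x) (hx : gradient V x = 0)
    (hsymm : ∀ v w, ⟪H v, w⟫ = ⟪H w, v⟫) {ε : ℝ} (hε : 0 < ε) :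
    ∃ r > 0, ∀ h : E, ‖h‖ < r → |V (x + h) - V x - ⟪H h, h⟫ / 2| ≤ ε * ‖h‖ ^ 2 := by
  have h1 := (hasFDerivAt_iff_isLittleO_nhds_zero.mp hH).bound hε
  obtain ⟨r, hr, hball⟩ := Metric.eventually_nhds_iff_ball.mp h1
  refine ⟨r, hr, fun h hh => ?_⟩
  set φ : E → ℝ := fun k => V (x + k) - V x - ⟪H k, k⟫ / 2 with hφ
  have hderiv : ∀ k : E, HasFDerivAt φ (innerSL ℝ (gradient V (x + k) - H k)) k := by
    intro k
    have hA : HasFDerivAt (fun k => V (x + k)) (innerSL ℝ (gradient V (x + k))) k :=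
      (hV (x + k)).hasGradientAt.hasFDerivAt.comp k ((hasFDerivAt_id k).const_add x)
    have hB := (H.hasFDerivAt (x := k)).inner ℝ (hasFDerivAt_id k)
    refine (((hA.sub_const (V x)).sub (hB.const_mul (1 / 2))).congr_fderiv ?_).congr_of_eventuallyEq
      ?_
    · ext v
      simp
      rw [hsymm v k]
      ring
    · refine Filter.Eventually.of_forall fun k => ?_
      simp [hφ]
      ring
  have hmv := (convex_closedBall (0 : E) ‖h‖).norm_image_sub_le_of_norm_hasFDerivWithin_le
    (f := φ) (C := ε * ‖h‖) (fun k _ => (hderiv k).hasFDerivWithinAt)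
    (fun k hk => by
      rw [innerSL_apply_norm]
      have hk' : ‖k‖ ≤ ‖h‖ := by simpa using hk
      have := hball k (by simpa using lt_of_le_of_lt hk' hh)
      rw [hx, sub_zero] at this
      exact this.trans (by gcongr))
    (x := 0) (y := h) (by simp) (by simp)
  have h0 : φ 0 = 0 := by simp [hφ]
  rw [h0, sub_zero, sub_zero, Real.norm_eq_abs] at hmv
  calc |V (x + h) - V x - ⟪H h, h⟫ / 2| ≤ ε * ‖h‖ * ‖h‖ := hmv
    _ = ε * ‖h‖ ^ 2 := by ring

/-- A convex function vanishing at `x` and positive elsewhere grows at least linearly away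
from `x`. -/
lemma exists_linear_lower_bound_of_convexOn {E : Type*} [NormedAddCommGroup E]
    [NormedSpace ℝ E] [ProperSpace E] {f : E → ℝ} (hf : ConvexOn ℝ Set.univ f)
    (hcont : Continuous f) {x : E} (hx : f x = 0) (hpos : ∀ y, y ≠ x → 0 < f y) {r : ℝ}
    (hr : 0 < r) : ∃ m > 0, ∀ y, r ≤ ‖y - x‖ → m * ‖y - x‖ ≤ f y := by
  obtain ⟨m, hm, hmin⟩ := (isCompact_sphere x r).exists_forall_le' hcont.continuousOn (a := 0)
    (fun y hy => hpos y (by rintro rfl; simp at hy; exact hr.ne hy))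
  refine ⟨m / r, div_pos hm hr, fun y hy => ?_⟩
  have hy0 : 0 < ‖y - x‖ := hr.trans_le hy
  set t := r / ‖y - x‖ with ht
  have ht0 : 0 < t := div_pos hr hy0
  have ht1 : t ≤ 1 := (div_le_one hy0).mpr hy
  have hc := hf.2 (Set.mem_univ x) (Set.mem_univ y) (sub_nonneg.mpr ht1) ht0.le (by ring)
  have hs : (1 - t) • x + t • y ∈ Metric.sphere x r := by
    rw [mem_sphere_iff_norm, show (1 - t) • x + t • y - x = t • (y - x) by module, norm_smul,
      Real.norm_of_nonneg ht0.le, ht, div_mul_cancel₀ _ hy0.ne']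
  have h1 := (hmin _ hs).trans hc
  rw [hx, smul_zero, zero_add, smul_eq_mul, ht, div_mul_eq_mul_div, le_div_iff₀ hy0] at h1
  rw [div_mul_eq_mul_div, div_le_iff₀ hr]
  linarith

lemma norm_smul_add_sq_of_inner_eq_zero {E : Type*} [NormedAddCommGroup E]
    [InnerProductSpace ℝ E] {u w : E} (hu : ‖u‖ = 1) (hw : ⟪u, w⟫ = 0) (s : ℝ) :
    ‖s • u + w‖ ^ 2 = s ^ 2 + ‖w‖ ^ 2 := by
  rw [norm_add_sq_real, norm_smul, hu, real_inner_smul_left, hw, Real.norm_eq_abs, mul_one,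
    sq_abs]
  ring

/-- Components along and orthogonal to a unit vector have norm at most that of the vector. -/
lemma norm_components_le {E : Type*} [NormedAddCommGroup E]
    [InnerProductSpace ℝ E] {u : E} (hu : ‖u‖ = 1) (h : E) :
    ⟪u, h - ⟪u, h⟫ • u⟫ = 0 ∧ ‖⟪u, h⟫ • u‖ ≤ ‖h‖ ∧ ‖h - ⟪u, h⟫ • u‖ ≤ ‖h‖ := by
  have h0 : ⟪u, h - ⟪u, h⟫ • u⟫ = 0 := by
    rw [inner_sub_right, real_inner_smul_right, real_inner_self_eq_norm_sq, hu]
    ring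
  have h1 := norm_smul_add_sq_of_inner_eq_zero hu h0 ⟪u, h⟫
  rw [add_sub_cancel] at h1
  refine ⟨h0, ?_, ?_⟩
  · rw [norm_smul, hu, mul_one, Real.norm_eq_abs]
    exact abs_le_of_sq_le_sq (by nlinarith [sq_nonneg ‖h - ⟪u, h⟫ • u‖]) (norm_nonneg _)
  · exact le_of_sq_le_sq (by nlinarith [sq_nonneg ⟪u, h⟫]) (norm_nonneg _)

lemma Wtilde_self {n : ℕ} (V : EuclideanSpace ℝ (Fin n) → ℝ)
    (p : EuclideanSpace ℝ (Fin n) → EuclideanSpace ℝ (Fin n) → ℝ) (α β ρ : ℝ)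
    (x u : EuclideanSpace ℝ (Fin n)) :
    Wtilde V p α β ρ x u x = (1 - β) * V x + ρ * p x x := by
  simp [Wtilde]
  ring

/-- Strict minimality of an index-1 saddle for `Wtilde`, for all large penalties, uniformly in
the unit eigenvector. -/
lemma exists_forall_Wtilde_self_lt {n : ℕ} {V : EuclideanSpace ℝ (Fin n) → ℝ}
    (hV : Differentiable ℝ V) {L : ℝ}
    (hL : ∀ a b : EuclideanSpace ℝ (Fin n), |V a - V b| ≤ L * ‖a - b‖)
    {p : EuclideanSpace ℝ (Fin n) → EuclideanSpace ℝ (Fin n) → ℝ}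
    {x : EuclideanSpace ℝ (Fin n)} (hg : DifferentiableAt ℝ (gradient V) x)
    (hx : gradient V x = 0) {μ : Fin n → ℝ} {w : Fin n → EuclideanSpace ℝ (Fin n)}
    (hw : Orthonormal ℝ w) (hHw : ∀ i, hess V x (w i) = μ i • w i) {i₀ : Fin n} {c : ℝ}
    (hμ₀ : μ i₀ < 0) (hc : 0 < c) (hμ : ∀ i, i ≠ i₀ → c ≤ μ i)
    (hconv : ConvexOn ℝ Set.univ (p x)) (hcont : Continuous (p x))
    (hp : ∀ y, 0 ≤ p x y) (hp0 : ∀ y, p x y = 0 ↔ x = y) {α β : ℝ} (hab : α + β > 1) :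
    ∃ ρbar : ℝ, 0 < ρbar ∧ ∀ ρ ≥ ρbar, ∀ u, ‖u‖ = 1 → hess V x u = μ i₀ • u →
      ∀ y, y ≠ x → Wtilde V p α β ρ x u x < Wtilde V p α β ρ x u y := by
  let b : OrthonormalBasis (Fin n) ℝ (EuclideanSpace ℝ (Fin n)) :=
    OrthonormalBasis.mk hw
      (hw.linearIndependent.span_eq_top_of_card_eq_finrank' (by simp)).ge
  have hb : ∀ i, hess V x (b i) = μ i • b i := by simpa [b] using hHw
  have hsymm : ∀ v w, ⟪hess V x v, w⟫ = ⟪hess V x w, v⟫ := fun v w => by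
    rw [inner_apply_eq_sum_of_eigenbasis _ b μ hb, inner_apply_eq_sum_of_eigenbasis _ b μ hb]
    exact Finset.sum_congr rfl fun i _ => by ring
  set K := |1 - α| + |α| + |β| + 1 with hK
  have hK0 : 0 < K := by positivity
  set κ := min ((α + β - 1) * -μ i₀) c with hκ
  have hκ0 : 0 < κ := lt_min (mul_pos (by linarith) (by linarith)) hc
  obtain ⟨r, hr, htaylor⟩ := exists_ball_abs_sub_quadratic_le hV
    (H := hess V x) hg.hasFDerivAt hx hsymm (ε := κ / (4 * K)) (by positivity)
  have hpx : p x x = 0 := (hp0 x).mpr rfl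
  obtain ⟨m, hm, hgrowth⟩ := exists_linear_lower_bound_of_convexOn hconv hcont hpx
    (fun y hy => lt_of_le_of_ne (hp y) fun h => hy ((hp0 y).mp h.symm).symm) hr
  refine ⟨(K * |L| + 1) / m, by positivity, fun ρ hρ u hu hHu y hy => ?_⟩
  have hρ' : K * |L| + 1 ≤ ρ * m := (div_le_iff₀ hm).mp hρ
  have hρ0 : 0 < ρ := lt_of_lt_of_le (by positivity) hρ
  obtain ⟨h, rfl⟩ : ∃ h, y = x + h := ⟨y - x, by abel⟩
  have hh : 0 < ‖h‖ := norm_pos_iff.mpr fun h0 => hy (by simp [h0])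
  obtain ⟨hperp, hle₁, hle₂⟩ := norm_components_le hu h
  rw [Wtilde_self, hpx, Wtilde, add_sub_cancel_left, add_sub_assoc x]
  set s := ⟪u, h⟫ with hs
  set k := h - s • u with hk
  have hhk : h = s • u + k := by rw [hk]; abel
  -- a common error bound for the three terms gives an error bound for their combination
  have hcomb : ∀ e₁ e₂ e₃ B : ℝ, |e₁| ≤ B → |e₂| ≤ B → |e₃| ≤ B →
      -((K - 1) * B) ≤ (1 - α) * e₁ + α * e₂ - β * e₃ := by
    intro e₁ e₂ e₃ B h₁ h₂ h₃
    have H₁ : |(1 - α) * e₁| ≤ |1 - α| * B := by rw [abs_mul]; gcongr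
    have H₂ : |α * e₂| ≤ |α| * B := by rw [abs_mul]; gcongr
    have H₃ : |β * e₃| ≤ |β| * B := by rw [abs_mul]; gcongr
    rw [abs_le] at H₁ H₂ H₃
    have : (K - 1) * B = |1 - α| * B + |α| * B + |β| * B := by rw [hK]; ring
    linarith [H₁.1, H₂.1, H₃.2]
  by_cases hlt : ‖h‖ < r
  · have hpos : 0 ≤ ρ * p x (x + h) := mul_nonneg hρ0.le (hp _)
    have hε : 0 ≤ κ / (4 * K) := by positivity
    have E₁ := htaylor h hlt
    have E₂ := (htaylor k (hle₂.trans_lt hlt)).trans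
      (show _ ≤ κ / (4 * K) * ‖h‖ ^ 2 by gcongr)
    have E₃ := (htaylor (s • u) (hle₁.trans_lt hlt)).trans
      (show _ ≤ κ / (4 * K) * ‖h‖ ^ 2 by gcongr)
    have hE := hcomb _ _ _ _ E₁ E₂ E₃
    have hus : ⟪hess V x (s • u), s • u⟫ = μ i₀ * s ^ 2 := by
      rw [map_smul, hHu, real_inner_smul_left, real_inner_smul_right, real_inner_smul_left,
        real_inner_self_eq_norm_sq, hu]
      ring
    have hsplit : ⟪hess V x h, h⟫ = μ i₀ * s ^ 2 + ⟪hess V x k, k⟫ := by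
      have hcross : ⟪hess V x (s • u), k⟫ = 0 := by
        rw [map_smul, hHu, real_inner_smul_left, real_inner_smul_left, hperp]
        ring
      conv_lhs => rw [hhk]
      rw [map_add, inner_add_left, inner_add_right, inner_add_right, hus, hcross,
        hsymm k, hcross]
      ring
    have hkk := mul_norm_sq_le_inner_of_orthogonal_eigenvector (hess V x) b μ hb i₀
      (hμ₀.trans hc) hμ (norm_ne_zero_iff.mp (by rw [hu]; exact one_ne_zero)) hHu hperp
    have hnorm : ‖h‖ ^ 2 = s ^ 2 + ‖k‖ ^ 2 := by
      conv_lhs => rw [hhk]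
      exact norm_smul_add_sq_of_inner_eq_zero hu hperp s
    have hq : κ * ‖h‖ ^ 2 ≤ (1 - α - β) * (μ i₀ * s ^ 2) + ⟪hess V x k, k⟫ := by
      have q₁ : κ * s ^ 2 ≤ (α + β - 1) * -μ i₀ * s ^ 2 := by
        gcongr
        exact min_le_left _ _
      have q₂ : κ * ‖k‖ ^ 2 ≤ c * ‖k‖ ^ 2 := by
        gcongr
        exact min_le_right _ _
      rw [hnorm]
      linarith
    have hbd : (K - 1) * (κ / (4 * K) * ‖h‖ ^ 2) ≤ κ * ‖h‖ ^ 2 / 4 := by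
      have : K * (κ / (4 * K) * ‖h‖ ^ 2) = κ * ‖h‖ ^ 2 / 4 := by field_simp
      have : 0 ≤ κ / (4 * K) * ‖h‖ ^ 2 := by positivity
      linarith
    have hfin : 0 < κ * ‖h‖ ^ 2 := by positivity
    rw [hus, hsplit] at hE
    linarith
  · have hB : ∀ v : EuclideanSpace ℝ (Fin n), ‖v‖ ≤ ‖h‖ → |V (x + v) - V x| ≤ |L| * ‖h‖ := by
      intro v hv
      have h1 := hL (x + v) x
      rw [add_sub_cancel_left] at h1
      calc |V (x + v) - V x| ≤ L * ‖v‖ := h1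
        _ ≤ |L| * ‖v‖ := by gcongr; exact le_abs_self L
        _ ≤ |L| * ‖h‖ := by gcongr
    have hE := hcomb _ _ _ _ (hB h le_rfl) (hB k hle₂) (hB (s • u) hle₁)
    have hgr := hgrowth (x + h) (by simpa using hlt)
    rw [add_sub_cancel_left] at hgr
    have h1 : (K * |L| + 1) * ‖h‖ ≤ ρ * p x (x + h) := calc
      (K * |L| + 1) * ‖h‖ ≤ ρ * m * ‖h‖ := by gcongr
      _ = ρ * (m * ‖h‖) := by ring
      _ ≤ ρ * p x (x + h) := by gcongr
    have h2 : 0 ≤ |L| * ‖h‖ := by positivity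
    linarith

/-- Theorem 3.1(1): under the assumptions on `V` (C³, Lipschitz, uniformly
bounded Hessian, nonempty finite set `𝒮₁` of non-degenerate index-1 saddle points, all
stationary points non-degenerate) and on the penalty `p` as in Assumption 3.1, and `α+β > 1`,
there is `ρ̄ > 0` such that for every `ρ ≥ ρ̄`, every `x* ∈ 𝒮₁` and every unit eigenvector
`u` of `∇²V(x*)` for `λ₁(x*)`, the point `x*` is the unique global minimizer of
`y ↦ W̃_ρ(y; x*, u)`. -/
theorem stmt_14 {n : ℕ} (hn : 2 ≤ n)
    (V : EuclideanSpace ℝ (Fin n) → ℝ)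
    (hV : ContDiff ℝ 3 V)
    (hVLip : ∃ L : ℝ, ∀ a b : EuclideanSpace ℝ (Fin n), |V a - V b| ≤ L * ‖a - b‖)
    (lamL lamU : ℝ)
    (hHessBdd : ∀ x v : EuclideanSpace ℝ (Fin n),
      lamL * ‖v‖ ^ 2 ≤ ⟪hess V x v, v⟫ ∧ ⟪hess V x v, v⟫ ≤ lamU * ‖v‖ ^ 2)
    (lam : Fin n → EuclideanSpace ℝ (Fin n) → ℝ)
    (hlamMono : ∀ x : EuclideanSpace ℝ (Fin n), Monotone fun i => lam i x)
    (hlamEig : ∀ x : EuclideanSpace ℝ (Fin n), ∃ w : Fin n → EuclideanSpace ℝ (Fin n),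
      Orthonormal ℝ w ∧ ∀ i, hess V x (w i) = lam i x • w i)
    (hS1ne : {x | gradient V x = 0 ∧ x ∈ Omega1 hn lam}.Nonempty)
    (hS1fin : {x | gradient V x = 0 ∧ x ∈ Omega1 hn lam}.Finite)
    (hnondeg : ∀ x : EuclideanSpace ℝ (Fin n), gradient V x = 0 → ∀ i, lam i x ≠ 0)
    (p : EuclideanSpace ℝ (Fin n) → EuclideanSpace ℝ (Fin n) → ℝ)
    (hpConv : ∀ x, ConvexOn ℝ Set.univ (p x))
    (hpC2 : ∀ x, ContDiff ℝ 2 (p x))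
    (hpHess0 : ∀ x y, iteratedFDeriv ℝ 2 (p x) y = 0 ↔ y = x)
    (hpNonneg : ∀ x y, 0 ≤ p x y)
    (hpZero : ∀ x y, p x y = 0 ↔ x = y)
    (hpStrong : ∀ ε : ℝ, 0 < ε → ∃ lamε : ℝ, 0 < lamε ∧
      ∀ x y : EuclideanSpace ℝ (Fin n), ε ≤ ‖x - y‖ →
        ∀ v, lamε * ‖v‖ ^ 2 ≤ iteratedFDeriv ℝ 2 (p x) y ![v, v])
    (α β : ℝ) (hab : α + β > 1) :
    ∃ ρbar : ℝ, 0 < ρbar ∧ ∀ ρ : ℝ, ρ ≥ ρbar →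
      ∀ xstar ∈ {x | gradient V x = 0 ∧ x ∈ Omega1 hn lam},
      ∀ u : EuclideanSpace ℝ (Fin n),
        ‖u‖ = 1 → hess V xstar u = lam ⟨0, by omega⟩ xstar • u →
        (∀ y, Wtilde V p α β ρ xstar u xstar ≤ Wtilde V p α β ρ xstar u y) ∧
        ∀ z : EuclideanSpace ℝ (Fin n),
          (∀ y, Wtilde V p α β ρ xstar u z ≤ Wtilde V p α β ρ xstar u y) → z = xstar := by
  obtain ⟨L, hL⟩ := hVLip
  have hdiff : Differentiable ℝ V := hV.differentiable (by norm_num)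
  have hgrad : Differentiable ℝ (gradient V) := by
    have h1 : ContDiff ℝ 1 (fderiv ℝ V) := hV.fderiv_right (by norm_num)
    exact ((InnerProductSpace.toDual ℝ (EuclideanSpace ℝ (Fin n))).symm.contDiff.comp
      h1).differentiable one_ne_zero
  have key : ∀ x ∈ {x | gradient V x = 0 ∧ x ∈ Omega1 hn lam}, ∃ ρbar : ℝ, 0 < ρbar ∧
      ∀ ρ ≥ ρbar, ∀ u, ‖u‖ = 1 → hess V x u = lam ⟨0, by omega⟩ x • u →
      ∀ y, y ≠ x → Wtilde V p α β ρ x u x < Wtilde V p α β ρ x u y := by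
    rintro x ⟨hx, hneg, hpos⟩
    obtain ⟨w, hw, hHw⟩ := hlamEig x
    refine exists_forall_Wtilde_self_lt hdiff hL (hgrad x) hx hw hHw hneg hpos (fun i hi => ?_)
      (hpConv x) (hpC2 x).continuous (hpNonneg x) (hpZero x) hab
    refine hlamMono x (Fin.mk_le_of_le_val ?_)
    exact Nat.one_le_iff_ne_zero.mpr fun h => hi (Fin.ext h)
  choose! R hR0 hR using key
  obtain ⟨M, hM⟩ := (hS1fin.image R).bddAbove
  refine ⟨max M 1, by positivity, fun ρ hρ x hx u hu hHu => ?_⟩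
  have hlt := hR x hx ρ ((hM (Set.mem_image_of_mem R hx)).trans ((le_max_left M 1).trans hρ))
    u hu hHu
  refine ⟨fun y => ?_, fun z hz => ?_⟩
  · rcases eq_or_ne y x with rfl | hy
    · exact le_rfl
    · exact (hlt y hy).le
  · by_contra hne
    exact absurd (hz x) (not_le.mpr (hlt z hne))
end
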